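/- arXiv:math/9608214 — 2 statements merged into one kernel-verified Lean document; each statement's English description precedes it below -/
import Mathlib

section
/- Let Γ and Δ be linear orders, 0 ∈ Δ a distinguished element, and τ : Δ → Δ a map with δ < τ(δ) for all δ ∈ Δ. Then for every d ∈ Δ^Γ and every well-ordered subset S ⊆ Γ, the support of d ⊕ S is contained in supp(d) ∪ S (so d ⊕ S again lies in Δ^Γ), and for any two well-ordered (possibly empty) subsets S, S' ⊆ Γ with S strictly contained in S', one has d ⊕ S < d ⊕ S' in the lexicographic order. -/
open Classical

/-- Given `τ : Δ → Δ`, the map `d ⊕ S` which applies `τ` to the components of `d` at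
indices in `S` and leaves the other components unchanged. -/
noncomputable def oplus {Γ Δ : Type*} (τ : Δ → Δ) (d : Γ → Δ) (S : Set Γ) : Γ → Δ :=
  fun γ => if γ ∈ S then τ (d γ) else d γ

/-- The lexicographic order on maps `Γ → Δ`: `a < b` iff there is an index `γ₀` such that
`a` and `b` agree at all indices below `γ₀` and `a γ₀ < b γ₀`. -/
def FunLexLT {Γ Δ : Type*} [LinearOrder Γ] [LinearOrder Δ] (a b : Γ → Δ) : Prop :=
  ∃ γ₀ : Γ, (∀ γ : Γ, γ < γ₀ → a γ = b γ) ∧ a γ₀ < b γ₀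

/-- Let `τ : Δ → Δ` satisfy `δ < τ δ` for all `δ`. For every `d : Γ → Δ` with well-ordered
support (relative to the distinguished element `z`): (1) for every well-ordered `S ⊆ Γ`,
the support of `d ⊕ S` is contained in `supp d ∪ S` (so `d ⊕ S` again has well-ordered
support and lies in `Δ^Γ`); (2) if `S, S'` are well-ordered (possibly empty) subsets of `Γ`
with `S` strictly contained in `S'`, then `d ⊕ S < d ⊕ S'` lexicographically. -/
theorem oplus_support_subset_and_strictMono
    {Γ Δ : Type*} [LinearOrder Γ] [LinearOrder Δ] (z : Δ)
    (τ : Δ → Δ) (hτ : ∀ δ : Δ, δ < τ δ)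
    (d : Γ → Δ) (hd : {γ : Γ | d γ ≠ z}.IsWF) :
    (∀ S : Set Γ, S.IsWF →
      {γ : Γ | oplus τ d S γ ≠ z} ⊆ {γ : Γ | d γ ≠ z} ∪ S) ∧
    (∀ S S' : Set Γ, S.IsWF → S'.IsWF → S ⊂ S' →
      FunLexLT (oplus τ d S) (oplus τ d S')) := by
  constructor
  · intro S _ γ hγ
    by_cases hS : γ ∈ S
    · exact Or.inr hS
    · exact Or.inl (by simpa [oplus, hS] using hγ)
  · intro S S' _ hS' hSS'
    have hwf : (S' \ S).IsWF := hS'.mono Set.sdiff_subset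
    have hne : (S' \ S).Nonempty := Set.nonempty_of_ssubset hSS'
    refine ⟨hwf.min hne, fun γ hγ => ?_, ?_⟩
    · have hmem : γ ∈ S ↔ γ ∈ S' :=
        ⟨fun h => hSS'.subset h, fun h => by_contra fun h' => hwf.not_lt_min hne ⟨h, h'⟩ hγ⟩
      simp only [oplus, hmem]
    · obtain ⟨h, h'⟩ := hwf.min_mem hne
      simpa [oplus, h, h'] using hτ _
end

section
/- Let Γ and Δ be linear orders, 0 ∈ Δ a distinguished element, and τ : Δ → Δ a map with δ < τ(δ) for all δ ∈ Δ. Let d, e ∈ Δ^Γ with d < e in the lexicographic order, and let β be the least element of supp(d) ∪ supp(e) with d(β) ≠ e(β) (so that d(β) < e(β)). Then for every nonempty well-ordered subset S ⊆ Γ all of whose elements are strictly greater than β, one has d < d ⊕ S < e in the lexicographic order. -/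
open Classical

/-- Let `τ : Δ → Δ` satisfy `δ < τ δ` for all `δ`. Let `d, e : Γ → Δ` have well-ordered
support (relative to the distinguished element `z`), with `d < e` lexicographically, and
let `β` be the least index at which `d` and `e` differ, with `d β < e β`. Then for every
nonempty well-ordered `S ⊆ Γ` all of whose elements are strictly greater than `β`,
we have `d < d ⊕ S < e` lexicographically. -/
theorem lt_oplus_lt {Γ Δ : Type*} [LinearOrder Γ] [LinearOrder Δ] (z : Δ)
    (τ : Δ → Δ) (hτ : ∀ δ : Δ, δ < τ δ)
    (d e : Γ → Δ) (hd : {γ : Γ | d γ ≠ z}.IsWF) (he : {γ : Γ | e γ ≠ z}.IsWF)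
    (hde : FunLexLT d e)
    (β : Γ) (hβ : IsLeast {γ : Γ | d γ ≠ e γ} β) (hβlt : d β < e β)
    (S : Set Γ) (hS : S.IsWF) (hSne : S.Nonempty) (hSβ : ∀ s ∈ S, β < s) :
    FunLexLT d (oplus τ d S) ∧ FunLexLT (oplus τ d S) e := by
  constructor
  · refine ⟨hS.min hSne, fun γ hγ => ?_, ?_⟩
    · exact (if_neg fun h => hS.not_lt_min hSne h hγ).symm
    · exact (hτ _).trans_eq (if_pos (hS.min_mem hSne)).symm
  · refine ⟨β, fun γ hγ => ?_, ?_⟩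
    · have hde_eq : d γ = e γ := by
        by_contra h
        exact (hβ.2 h).not_gt hγ
      exact (if_neg fun h => (hSβ γ h).not_gt hγ).trans hde_eq
    · exact (if_neg fun h => lt_irrefl β (hSβ β h)).trans_lt hβlt
end
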